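/- Let N be a submultiplicative, unitarily invariant norm on the n×n complex matrices, let m ≥ 1, and let α_j ∈ [0, π/2) for j = 1, …, m. If X_j ∈ M^s_{n,α_j} for each j, then ω_N(X₁X₂⋯X_m) ≤ (∏_{j=1}^m sec(α_j)) · ω_N(X₁)·ω_N(X₂)⋯ω_N(X_m). -/

import Mathlib

open scoped ComplexOrder Matrix

/-- The Hermitian (real) part of a matrix: `Re(X) = (X + X*)/2`. -/
noncomputable def matRe {n : ℕ} (X : Matrix (Fin n) (Fin n) ℂ) :
    Matrix (Fin n) (Fin n) ℂ :=
  (1 / 2 : ℂ) • (X + Xᴴ)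

/-- The skew (imaginary) part of a matrix: `Im(X) = (X - X*)/(2i)`. -/
noncomputable def matIm {n : ℕ} (X : Matrix (Fin n) (Fin n) ℂ) :
    Matrix (Fin n) (Fin n) ℂ :=
  (1 / (2 * Complex.I)) • (X - Xᴴ)

/-- The generalized numerical radius induced by a norm `N`:
`ω_N(X) = sup_θ N(Re(e^{iθ} X))`. -/
noncomputable def gnr {n : ℕ} (N : Matrix (Fin n) (Fin n) ℂ → ℝ)
    (X : Matrix (Fin n) (Fin n) ℂ) : ℝ :=
  ⨆ θ : ℝ, N (matRe (Complex.exp (θ * Complex.I) • X))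

/-- The numerical range `W(X) = {⟨Xx, x⟩ : ‖x‖ = 1}` (standard inner product on ℂⁿ). -/
def numRange {n : ℕ} (X : Matrix (Fin n) (Fin n) ℂ) : Set ℂ :=
  { z | ∃ x : Fin n → ℂ, star x ⬝ᵥ x = 1 ∧ z = star x ⬝ᵥ X.mulVec x }

/-- The sector `S_α = {z : Re z > 0, |Im z| ≤ tan(α) Re z}`. -/
def sector (α : ℝ) : Set ℂ :=
  { z | 0 < z.re ∧ |z.im| ≤ Real.tan α * z.re }

/-- The class `M^s_{n,α}` of matrices `X` such that `W(zX) ⊆ S_α` for some unimodular `z`. -/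
def sectClass (n : ℕ) (α : ℝ) : Set (Matrix (Fin n) (Fin n) ℂ) :=
  { X | ∃ z : ℂ, ‖z‖ = 1 ∧ numRange (z • X) ⊆ sector α }

open Matrix in
lemma aux_diag {n : ℕ} {P : Matrix (Fin n) (Fin n) ℂ} (hP : P.PosDef) :
    ∃ U ∈ Matrix.unitaryGroup (Fin n) ℂ, ∃ d : Fin n → ℝ, (∀ i, 0 < d i) ∧
      P = U * Matrix.diagonal (fun i => (d i : ℂ)) * Uᴴ := by
  refine ⟨hP.1.eigenvectorUnitary, hP.1.eigenvectorUnitary.2, hP.1.eigenvalues,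
    fun i => hP.eigenvalues_pos i, ?_⟩
  conv_lhs => rw [hP.1.spectral_theorem, Unitary.conjStarAlgAut_apply]
  rfl

lemma aux_uU {n : ℕ} {U : Matrix (Fin n) (Fin n) ℂ} (hU : U ∈ Matrix.unitaryGroup (Fin n) ℂ) :
    Uᴴ * U = 1 := Matrix.mem_unitaryGroup_iff'.1 hU

lemma aux_Uu {n : ℕ} {U : Matrix (Fin n) (Fin n) ℂ} (hU : U ∈ Matrix.unitaryGroup (Fin n) ℂ) :
    U * Uᴴ = 1 := Matrix.mem_unitaryGroup_iff.1 hU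

lemma aux_star {n : ℕ} {U : Matrix (Fin n) (Fin n) ℂ} (hU : U ∈ Matrix.unitaryGroup (Fin n) ℂ) :
    Uᴴ ∈ Matrix.unitaryGroup (Fin n) ℂ := by
  rw [Matrix.mem_unitaryGroup_iff, Matrix.star_eq_conjTranspose, Matrix.conjTranspose_conjTranspose]
  exact aux_uU hU

lemma aux_conj_mul {n : ℕ} {U : Matrix (Fin n) (Fin n) ℂ}
    (hU : U ∈ Matrix.unitaryGroup (Fin n) ℂ) (a b : Matrix (Fin n) (Fin n) ℂ) :
    (U * a * Uᴴ) * (U * b * Uᴴ) = U * (a * b) * Uᴴ := by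
  calc (U * a * Uᴴ) * (U * b * Uᴴ) = U * a * (Uᴴ * U) * b * Uᴴ := by simp only [mul_assoc]
    _ = _ := by rw [aux_uU hU]; simp only [mul_assoc, mul_one]

lemma aux_conj_posDef {n : ℕ} {U : Matrix (Fin n) (Fin n) ℂ}
    (hU : U ∈ Matrix.unitaryGroup (Fin n) ℂ) {d : Fin n → ℝ} (hd : ∀ i, 0 < d i) :
    (U * Matrix.diagonal (fun i => (d i : ℂ)) * Uᴴ).PosDef := by
  have hu : IsUnit U := IsUnit.of_mul_eq_one _ (aux_Uu hU)
  rw [← Matrix.star_eq_conjTranspose, Matrix.IsUnit.posDef_star_right_conjugate_iff hu]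
  rw [Matrix.posDef_diagonal_iff]
  intro i
  exact_mod_cast hd i

lemma aux_sqrt {n : ℕ} {P : Matrix (Fin n) (Fin n) ℂ} (hP : P.PosDef) :
    ∃ S : Matrix (Fin n) (Fin n) ℂ, S.PosDef ∧ S * S = P := by
  obtain ⟨U, hU, d, hd, rfl⟩ := aux_diag hP
  refine ⟨U * Matrix.diagonal (fun i => ((Real.sqrt (d i) : ℝ) : ℂ)) * Uᴴ,
    aux_conj_posDef hU (fun i => Real.sqrt_pos.2 (hd i)), ?_⟩
  rw [aux_conj_mul hU, Matrix.diagonal_mul_diagonal]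
  congr 3
  ext i
  rw [← Complex.ofReal_mul, Real.mul_self_sqrt (hd i).le]

lemma aux_polar {n : ℕ} {A : Matrix (Fin n) (Fin n) ℂ} (hA : IsUnit A) :
    ∃ W ∈ Matrix.unitaryGroup (Fin n) ℂ, ∃ P : Matrix (Fin n) (Fin n) ℂ, P.PosDef ∧
      A = W * P ∧ P * P = Aᴴ * A := by
  have h1 : (Aᴴ * A).PosDef := Matrix.PosDef.conjTranspose_mul_self _
    (Matrix.mulVec_injective_of_isUnit hA)
  obtain ⟨P, hP, hPP⟩ := aux_sqrt h1
  have hPu : IsUnit P.det := (Matrix.isUnit_iff_isUnit_det _).1 hP.isUnit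
  have hPi : (P⁻¹)ᴴ = P⁻¹ := hP.inv.1
  refine ⟨A * P⁻¹, ?_, P, hP, ?_, hPP⟩
  · rw [Matrix.mem_unitaryGroup_iff', Matrix.star_eq_conjTranspose, Matrix.conjTranspose_mul, hPi]
    calc P⁻¹ * Aᴴ * (A * P⁻¹) = P⁻¹ * (Aᴴ * A) * P⁻¹ := by simp only [mul_assoc]
      _ = (P⁻¹ * P) * (P * P⁻¹) := by rw [← hPP]; simp only [mul_assoc]
      _ = 1 := by rw [Matrix.nonsing_inv_mul _ hPu, Matrix.mul_nonsing_inv _ hPu, mul_one]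
  · rw [mul_assoc, Matrix.nonsing_inv_mul _ hPu, mul_one]

lemma aux_contr {n : ℕ} {K : Matrix (Fin n) (Fin n) ℂ} (hK : IsUnit K)
    (hK1 : (1 - Kᴴ * K).PosSemidef) :
    ∃ V₁ ∈ Matrix.unitaryGroup (Fin n) ℂ, ∃ V₂ ∈ Matrix.unitaryGroup (Fin n) ℂ,
      K = (1 / 2 : ℂ) • (V₁ + V₂) := by
  obtain ⟨W, hW, R, hR, rfl, hRR⟩ := aux_polar hK
  rw [← hRR] at hK1
  obtain ⟨U, hU, d, hd, rfl⟩ := aux_diag hR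
  have hd1 : ∀ i, d i ^ 2 ≤ 1 := by
    have := hK1.conjTranspose_mul_mul_same U
    rw [aux_conj_mul hU, mul_sub, sub_mul, mul_one, aux_uU hU] at this
    have e : Uᴴ * (U * (Matrix.diagonal (fun i => (d i : ℂ)) * Matrix.diagonal (fun i => (d i : ℂ)))
        * Uᴴ) * U = Matrix.diagonal (fun i => (d i : ℂ) * d i) := by
      rw [Matrix.diagonal_mul_diagonal]
      simp only [mul_assoc, aux_uU hU, mul_one]
      rw [← mul_assoc, aux_uU hU, one_mul]
    rw [e, ← Matrix.diagonal_one, Matrix.diagonal_sub, Matrix.posSemidef_diagonal_iff] at this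
    intro i
    have h := this i
    have : (0 : ℝ) ≤ 1 - d i * d i := by exact_mod_cast h
    nlinarith
  let s : Fin n → ℝ := fun i => Real.sqrt (1 - d i ^ 2)
  have hs : ∀ i, s i * s i = 1 - d i ^ 2 := fun i =>
    Real.mul_self_sqrt (by linarith [hd1 i])
  have key : ∀ ε : ℝ, ε ^ 2 = 1 → U * Matrix.diagonal
      (fun i => (d i : ℂ) + ε * s i * Complex.I) * Uᴴ ∈ Matrix.unitaryGroup (Fin n) ℂ := by
    intro ε hε
    rw [Matrix.mem_unitaryGroup_iff, Matrix.star_eq_conjTranspose]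
    rw [Matrix.conjTranspose_mul, Matrix.conjTranspose_mul, Matrix.conjTranspose_conjTranspose,
      ← mul_assoc U, aux_conj_mul hU, Matrix.diagonal_conjTranspose, Matrix.diagonal_mul_diagonal]
    have : (fun i => ((d i : ℂ) + ε * s i * Complex.I) *
        star (fun i => (d i : ℂ) + ε * s i * Complex.I) i) = fun _ => 1 := by
      ext i
      simp only [Pi.star_apply, Complex.star_def, map_add, map_mul, Complex.conj_ofReal,
        Complex.conj_I]
      have h2 : (s i : ℂ) * s i = 1 - (d i : ℂ) ^ 2 := by exact_mod_cast hs i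
      have h3 : (ε : ℂ) ^ 2 = 1 := by exact_mod_cast hε
      linear_combination (-(ε:ℂ)^2 * s i * s i) * Complex.I_sq + s i * s i * h3 + h2
    rw [this, Matrix.diagonal_one, mul_one, aux_Uu hU]
  refine ⟨W * _, mul_mem hW (key 1 (by norm_num)), W * _, mul_mem hW (key (-1) (by norm_num)), ?_⟩
  rw [← mul_add, ← add_mul, ← mul_add, Matrix.diagonal_add, ← mul_smul_comm, ← smul_mul_assoc,
    ← mul_smul_comm, ← Matrix.diagonal_smul]
  congr 4
  ext i
  simp
  ring

section
variable {n : ℕ} {N : Matrix (Fin n) (Fin n) ℂ → ℝ}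

lemma aux_nonneg (hNs : ∀ (c : ℂ) (A : Matrix (Fin n) (Fin n) ℂ), N (c • A) = ‖c‖ * N A)
    (hNa : ∀ A B : Matrix (Fin n) (Fin n) ℂ, N (A + B) ≤ N A + N B)
    (A : Matrix (Fin n) (Fin n) ℂ) : 0 ≤ N A := by
  have h := hNa A ((-1 : ℂ) • A)
  have h0 := hNs 0 0
  rw [hNs] at h
  have e : A + (-1 : ℂ) • A = 0 := by simp
  simp at h0
  rw [e, h0] at h
  simp at h
  linarith

lemma aux_uL (hUI : ∀ U V A : Matrix (Fin n) (Fin n) ℂ, U ∈ Matrix.unitaryGroup (Fin n) ℂ →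
      V ∈ Matrix.unitaryGroup (Fin n) ℂ → N (U * A * V) = N A)
    {U : Matrix (Fin n) (Fin n) ℂ} (hU : U ∈ Matrix.unitaryGroup (Fin n) ℂ)
    (A : Matrix (Fin n) (Fin n) ℂ) : N (U * A) = N A := by
  have := hUI U 1 A hU (one_mem _)
  rwa [mul_one] at this

lemma aux_uR (hUI : ∀ U V A : Matrix (Fin n) (Fin n) ℂ, U ∈ Matrix.unitaryGroup (Fin n) ℂ →
      V ∈ Matrix.unitaryGroup (Fin n) ℂ → N (U * A * V) = N A)
    {U : Matrix (Fin n) (Fin n) ℂ} (hU : U ∈ Matrix.unitaryGroup (Fin n) ℂ)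
    (A : Matrix (Fin n) (Fin n) ℂ) : N (A * U) = N A := by
  have := hUI 1 U A (one_mem _) hU
  rwa [one_mul] at this

lemma aux_adj (hUI : ∀ U V A : Matrix (Fin n) (Fin n) ℂ, U ∈ Matrix.unitaryGroup (Fin n) ℂ →
      V ∈ Matrix.unitaryGroup (Fin n) ℂ → N (U * A * V) = N A)
    {A : Matrix (Fin n) (Fin n) ℂ} (hA : IsUnit A) : N Aᴴ = N A := by
  obtain ⟨W, hW, P, hP, rfl, -⟩ := aux_polar hA
  rw [Matrix.conjTranspose_mul, hP.1.eq, aux_uL hUI hW, aux_uR hUI (aux_star hW)]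

lemma aux_mono (hNs : ∀ (c : ℂ) (A : Matrix (Fin n) (Fin n) ℂ), N (c • A) = ‖c‖ * N A)
    (hNa : ∀ A B : Matrix (Fin n) (Fin n) ℂ, N (A + B) ≤ N A + N B)
    (hUI : ∀ U V A : Matrix (Fin n) (Fin n) ℂ, U ∈ Matrix.unitaryGroup (Fin n) ℂ →
      V ∈ Matrix.unitaryGroup (Fin n) ℂ → N (U * A * V) = N A)
    {P Q : Matrix (Fin n) (Fin n) ℂ} (hP : P.PosDef) (hQ : Q.PosDef)
    (hPQ : (Q - P).PosSemidef) : N P ≤ N Q := by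
  obtain ⟨S, hS, rfl⟩ := aux_sqrt hP
  obtain ⟨T, hT, rfl⟩ := aux_sqrt hQ
  have hTu : IsUnit T.det := (Matrix.isUnit_iff_isUnit_det _).1 hT.isUnit
  have hTi : (T⁻¹)ᴴ = T⁻¹ := hT.inv.1
  have hKu : IsUnit (S * T⁻¹) := hS.isUnit.mul hT.inv.isUnit
  have hK1 : (1 - (S * T⁻¹)ᴴ * (S * T⁻¹)).PosSemidef := by
    have := hPQ.conjTranspose_mul_mul_same T⁻¹
    rw [hTi, mul_sub, sub_mul, ← mul_assoc, Matrix.nonsing_inv_mul _ hTu, one_mul,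
      Matrix.mul_nonsing_inv _ hTu] at this
    rw [Matrix.conjTranspose_mul, hTi, hS.1.eq]
    simpa only [mul_assoc] using this
  have hKT : S * T⁻¹ * T = S := by rw [mul_assoc, Matrix.nonsing_inv_mul _ hTu, mul_one]
  have hTK : T * (S * T⁻¹)ᴴ = S := by
    rw [Matrix.conjTranspose_mul, hTi, hS.1.eq, ← mul_assoc, Matrix.mul_nonsing_inv _ hTu, one_mul]
  have e : S * S = S * T⁻¹ * (T * T) * (S * T⁻¹)ᴴ := by
    conv_lhs => rw [← hTK]
    rw [hTK]
    conv_lhs => rw [← hKT]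
    conv_lhs => 
      arg 2
      rw [hKT, ← hTK]
    simp only [mul_assoc]
  rw [e]
  obtain ⟨V₁, h₁, V₂, h₂, hV⟩ := aux_contr hKu hK1
  rw [hV]
  have l : ∀ B, N (((1 / 2 : ℂ) • (V₁ + V₂)) * B) ≤ N B := by
    intro B
    rw [smul_mul_assoc, hNs, add_mul]
    have := hNa (V₁ * B) (V₂ * B)
    rw [aux_uL hUI h₁, aux_uL hUI h₂] at this
    norm_num
    linarith
  have r : ∀ B, N (B * ((1 / 2 : ℂ) • (V₁ + V₂))ᴴ) ≤ N B := by
    intro B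
    rw [Matrix.conjTranspose_smul, mul_smul_comm, hNs, Matrix.conjTranspose_add, mul_add]
    have := hNa (B * V₁ᴴ) (B * V₂ᴴ)
    rw [aux_uR hUI (aux_star h₁), aux_uR hUI (aux_star h₂)] at this
    norm_num
    linarith
  exact (r _).trans (l _)

end

/-- quadratic form of a sectorial matrix on arbitrary vectors -/
lemma aux_sect {n : ℕ} {A : Matrix (Fin n) (Fin n) ℂ} {α : ℝ} (h : numRange A ⊆ sector α)
    {x : Fin n → ℂ} (hx : x ≠ 0) : star x ⬝ᵥ A.mulVec x ∈ sector α := by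
  have h0 : 0 < star x ⬝ᵥ x := Matrix.dotProduct_star_self_pos_iff.2 hx
  obtain ⟨r, hr, hrx⟩ : ∃ r : ℝ, 0 < r ∧ star x ⬝ᵥ x = r := by
    refine ⟨(star x ⬝ᵥ x).re, (Complex.pos_iff.1 h0).1, ?_⟩
    apply Complex.ext
    · simp
    · simp [← (Complex.pos_iff.1 h0).2]
  have hs := Real.sqrt_pos.2 hr
  have hss := Real.mul_self_sqrt hr.le
  have hssC : (Real.sqrt r : ℂ) * Real.sqrt r = r := by exact_mod_cast hss
  set s := Real.sqrt r
  have hsC : (s : ℂ) ≠ 0 := by exact_mod_cast hs.ne'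
  have st : star ((s : ℂ)⁻¹ • x) = (s : ℂ)⁻¹ • star x := by
    rw [star_smul]; simp
  have := @h (star ((s : ℂ)⁻¹ • x) ⬝ᵥ A.mulVec ((s : ℂ)⁻¹ • x)) ⟨(s : ℂ)⁻¹ • x, by
    rw [st, smul_dotProduct, dotProduct_smul, hrx, ← hssC, smul_eq_mul, smul_eq_mul]
    field_simp, rfl⟩
  rw [st, Matrix.mulVec_smul, smul_dotProduct, dotProduct_smul, smul_eq_mul, smul_eq_mul,
    ← mul_assoc, ← mul_inv, hssC, ← Complex.ofReal_inv] at this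
  have hi := inv_pos.2 hr
  obtain ⟨a, b⟩ := this
  rw [Complex.re_ofReal_mul] at a b
  rw [Complex.im_ofReal_mul, abs_mul, abs_of_pos hi] at b
  refine ⟨pos_of_mul_pos_right a hi.le, ?_⟩
  have : r⁻¹ * |(star x ⬝ᵥ A.mulVec x).im| ≤ r⁻¹ * (Real.tan α * (star x ⬝ᵥ A.mulVec x).re) := by
    linarith
  exact le_of_mul_le_mul_left this hi

lemma aux_form {n : ℕ} {A : Matrix (Fin n) (Fin n) ℂ} {α : ℝ} (hα0 : 0 ≤ α)
    (hα1 : α < Real.pi / 2) (h : numRange A ⊆ sector α) (w x : Fin n → ℂ) :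
    2 * Real.cos α * (star w ⬝ᵥ A.mulVec x).re ≤
      (star w ⬝ᵥ A.mulVec w).re + (star x ⬝ᵥ A.mulVec x).re := by
  have hc : 0 < Real.cos α := Real.cos_pos_of_mem_Ioo ⟨by linarith, hα1⟩
  have hs : 0 ≤ Real.sin α := Real.sin_nonneg_of_nonneg_of_le_pi hα0 (by linarith)
  have hsc := Real.sin_sq_add_cos_sq α
  have q : ∀ u : Fin n → ℂ, 0 ≤ (star u ⬝ᵥ A.mulVec u).re ∧
      Real.cos α * |(star u ⬝ᵥ A.mulVec u).im| ≤ Real.sin α * (star u ⬝ᵥ A.mulVec u).re := by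
    intro u
    by_cases hu : u = 0
    · simp [hu]
    · obtain ⟨a, b⟩ := aux_sect h hu
      refine ⟨a.le, ?_⟩
      rw [Real.tan_eq_sin_div_cos] at b
      calc _ ≤ Real.cos α * (Real.sin α / Real.cos α * (star u ⬝ᵥ A.mulVec u).re) := by gcongr
        _ = _ := by field_simp
  have ex : ∀ ζ : ℂ, star (w - ζ • x) ⬝ᵥ A.mulVec (w - ζ • x) =
      star w ⬝ᵥ A.mulVec w - ζ * (star w ⬝ᵥ A.mulVec x) - star ζ * (star x ⬝ᵥ A.mulVec w)
        + star ζ * ζ * (star x ⬝ᵥ A.mulVec x) := by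
    intro ζ
    simp only [star_sub, star_smul, Matrix.mulVec_sub, Matrix.mulVec_smul, sub_dotProduct,
      dotProduct_sub, smul_dotProduct, dotProduct_smul, smul_eq_mul]
    ring
  have qw := q w
  have qx := q x
  have q1 := q (w - (⟨Real.cos α, Real.sin α⟩ : ℂ) • x)
  have q2 := q (w - (⟨Real.cos α, -Real.sin α⟩ : ℂ) • x)
  have q3 := q (w - (⟨0, 1⟩ : ℂ) • x)
  rw [ex] at q1 q2 q3
  generalize star w ⬝ᵥ A.mulVec w = a at *
  generalize star x ⬝ᵥ A.mulVec x = b at *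
  generalize star w ⬝ᵥ A.mulVec x = p at *
  generalize star x ⬝ᵥ A.mulVec w = r at *
  simp only [Complex.star_def, Complex.add_re, Complex.add_im, Complex.sub_re, Complex.sub_im,
    Complex.mul_re, Complex.mul_im, Complex.conj_re, Complex.conj_im] at q1 q2 q3
  rcases hs.eq_or_lt with hs | hs
  · have hc1 : Real.cos α = 1 := by nlinarith
    rw [hc1, ← hs] at q1 q2 q3 qw qx
    rw [hc1]
    simp at q1 q2 q3 qw qx
    linarith [q1.1, q3.2]
  · set c := Real.cos α
    set s := Real.sin α
    have e1 := mul_le_mul_of_nonneg_left (neg_le_abs _) hc.le |>.trans q1.2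
    have e2 := mul_le_mul_of_nonneg_left (le_abs_self _) hc.le |>.trans q2.2
    have : 0 ≤ s * (a.re + b.re - 2 * c * p.re) := by
      linear_combination (1 / 2) * e1 + (1 / 2) * e2 + s * b.re * hsc
    linarith [nonneg_of_mul_nonneg_right this hs]

lemma aux_psd {n : ℕ} {M : Matrix (Fin n) (Fin n) ℂ} (hM : M.IsHermitian)
    (h : ∀ x : Fin n → ℂ, 0 ≤ (star x ⬝ᵥ M.mulVec x).re) : M.PosSemidef := by
  refine Matrix.PosSemidef.of_dotProduct_mulVec_nonneg hM fun x => ?_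
  have := hM.im_star_dotProduct_mulVec_self x
  rw [Complex.nonneg_iff]
  exact ⟨h x, this.symm⟩

lemma aux_pd {n : ℕ} {M : Matrix (Fin n) (Fin n) ℂ} (hM : M.IsHermitian)
    (h : ∀ x : Fin n → ℂ, x ≠ 0 → 0 < (star x ⬝ᵥ M.mulVec x).re) : M.PosDef := by
  refine Matrix.PosDef.of_dotProduct_mulVec_pos hM fun x hx => ?_
  have := hM.im_star_dotProduct_mulVec_self x
  rw [Complex.pos_iff]
  exact ⟨h x hx, this.symm⟩

lemma aux_matRe_herm {n : ℕ} (A : Matrix (Fin n) (Fin n) ℂ) : (matRe A).IsHermitian := by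
  unfold matRe Matrix.IsHermitian
  rw [Matrix.conjTranspose_smul, Matrix.conjTranspose_add, Matrix.conjTranspose_conjTranspose,
    add_comm]
  simp

lemma aux_matRe_form {n : ℕ} (A : Matrix (Fin n) (Fin n) ℂ) (x : Fin n → ℂ) :
    (star x ⬝ᵥ (matRe A).mulVec x).re = (star x ⬝ᵥ A.mulVec x).re := by
  have e : star x ⬝ᵥ (Aᴴ).mulVec x = star (star x ⬝ᵥ A.mulVec x) := by
    rw [← Matrix.star_dotProduct, Matrix.star_mulVec, Matrix.dotProduct_mulVec]
  unfold matRe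
  rw [Matrix.smul_mulVec, Matrix.add_mulVec, dotProduct_smul, dotProduct_add, e, smul_eq_mul]
  simp
  ring

lemma aux_unit {n : ℕ} {A : Matrix (Fin n) (Fin n) ℂ} {α : ℝ} (h : numRange A ⊆ sector α) :
    IsUnit A := by
  rw [← Matrix.mulVec_injective_iff_isUnit]
  intro x y hxy
  by_contra hne
  have h1 := (aux_sect h (sub_ne_zero.2 hne)).1
  rw [Matrix.mulVec_sub, hxy] at h1
  simp at h1

lemma aux_main {n : ℕ} {N : Matrix (Fin n) (Fin n) ℂ → ℝ}
    (hNs : ∀ (c : ℂ) (A : Matrix (Fin n) (Fin n) ℂ), N (c • A) = ‖c‖ * N A)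
    (hNa : ∀ A B : Matrix (Fin n) (Fin n) ℂ, N (A + B) ≤ N A + N B)
    (hUI : ∀ U V A : Matrix (Fin n) (Fin n) ℂ, U ∈ Matrix.unitaryGroup (Fin n) ℂ →
      V ∈ Matrix.unitaryGroup (Fin n) ℂ → N (U * A * V) = N A)
    {A : Matrix (Fin n) (Fin n) ℂ} {α : ℝ} (hα0 : 0 ≤ α)
    (hα1 : α < Real.pi / 2) (h : numRange A ⊆ sector α) :
    N A ≤ (Real.cos α)⁻¹ * N (matRe A) := by
  have hc : 0 < Real.cos α := Real.cos_pos_of_mem_Ioo ⟨by linarith, hα1⟩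
  have hH : (matRe A).PosDef := aux_pd (aux_matRe_herm A) fun x hx => by
    rw [aux_matRe_form]; exact (aux_sect h hx).1
  obtain ⟨W, hW, P, hP, hA, -⟩ := aux_polar (aux_unit h)
  have hPA : P = Wᴴ * A := by rw [hA, ← mul_assoc, aux_uU hW, one_mul]
  set H := matRe A with hHdef
  have hWH : (Wᴴ * H * W).PosDef := by
    have hu : IsUnit W := IsUnit.of_mul_eq_one _ (aux_Uu hW)
    rw [← Matrix.star_eq_conjTranspose, Matrix.IsUnit.posDef_star_left_conjugate_iff hu]
    exact hH
  have hk : (0 : ℂ) < (((2 * Real.cos α)⁻¹ : ℝ) : ℂ) := by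
    have : 0 < (2 * Real.cos α)⁻¹ := by positivity
    exact_mod_cast this
  have hQ : ((((2 * Real.cos α)⁻¹ : ℝ) : ℂ) • (Wᴴ * H * W + H)).PosDef := (hWH.add hH).smul hk
  have hPQ : ((((2 * Real.cos α)⁻¹ : ℝ) : ℂ) • (Wᴴ * H * W + H) - P).PosSemidef := by
    refine aux_psd (hQ.1.sub hP.1) fun x => ?_
    have h1 := aux_form hα0 hα1 h (W.mulVec x) x
    have mv : ∀ B : Matrix (Fin n) (Fin n) ℂ, ∀ y, star x ⬝ᵥ (Wᴴ).mulVec y =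
        star (W.mulVec x) ⬝ᵥ y := by
      intro B y
      rw [Matrix.star_mulVec, Matrix.dotProduct_mulVec]
    rw [Matrix.sub_mulVec, Matrix.smul_mulVec, Matrix.add_mulVec, dotProduct_sub, dotProduct_smul,
      dotProduct_add, hPA, mul_assoc, ← Matrix.mulVec_mulVec, ← Matrix.mulVec_mulVec,
      ← Matrix.mulVec_mulVec, mv A, mv A, smul_eq_mul, Complex.sub_re, Complex.re_ofReal_mul,
      Complex.add_re, aux_matRe_form, aux_matRe_form, sub_nonneg, inv_mul_eq_div, le_div_iff₀ (by positivity)]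
    linarith
  have h2 := aux_mono hNs hNa hUI hP hQ hPQ
  have h3 := hNa (Wᴴ * H * W) H
  rw [hUI _ _ _ (aux_star hW) hW] at h3
  have h4 : N A = N P := by rw [hA, aux_uL hUI hW]
  have h5 : ‖(((2 * Real.cos α)⁻¹ : ℝ) : ℂ)‖ = (2 * Real.cos α)⁻¹ := by
    rw [Complex.norm_real, Real.norm_of_nonneg (by positivity)]
  rw [hNs, h5] at h2
  rw [h4]
  calc N P ≤ (2 * Real.cos α)⁻¹ * N (Wᴴ * H * W + H) := h2
    _ ≤ (2 * Real.cos α)⁻¹ * (N H + N H) := by gcongr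
    _ = _ := by field_simp; ring

lemma aux_prod {n : ℕ} {N : Matrix (Fin n) (Fin n) ℂ → ℝ} (hN : ∀ A, 0 ≤ N A)
    (hSM : ∀ A B : Matrix (Fin n) (Fin n) ℂ, N (A * B) ≤ N A * N B)
    {m : ℕ} (X : Fin (m + 1) → Matrix (Fin n) (Fin n) ℂ) :
    N (List.ofFn X).prod ≤ ∏ j, N (X j) := by
  induction m with
  | zero => simp
  | succ m ih =>
    rw [List.ofFn_succ, List.prod_cons, Fin.prod_univ_succ]
    exact (hSM _ _).trans (mul_le_mul_of_nonneg_left (ih _) (hN _))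

theorem stmt_6 {n : ℕ} (N : Matrix (Fin n) (Fin n) ℂ → ℝ)
    (hN0 : ∀ A : Matrix (Fin n) (Fin n) ℂ, N A = 0 ↔ A = 0)
    (hNs : ∀ (c : ℂ) (A : Matrix (Fin n) (Fin n) ℂ), N (c • A) = ‖c‖ * N A)
    (hNa : ∀ A B : Matrix (Fin n) (Fin n) ℂ, N (A + B) ≤ N A + N B)
    (hUI : ∀ U V A : Matrix (Fin n) (Fin n) ℂ, U ∈ Matrix.unitaryGroup (Fin n) ℂ →
      V ∈ Matrix.unitaryGroup (Fin n) ℂ → N (U * A * V) = N A)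
    (hSM : ∀ A B : Matrix (Fin n) (Fin n) ℂ, N (A * B) ≤ N A * N B)
    {m : ℕ} (hm : 1 ≤ m) (α : Fin m → ℝ)
    (hα : ∀ j, 0 ≤ α j ∧ α j < Real.pi / 2)
    (X : Fin m → Matrix (Fin n) (Fin n) ℂ)
    (hX : ∀ j, X j ∈ sectClass n (α j)) :
    gnr N (List.ofFn X).prod ≤ (∏ j, (Real.cos (α j))⁻¹) * ∏ j, gnr N (X j) := by
  have hN := aux_nonneg hNs hNa
  have hre : ∀ (A : Matrix (Fin n) (Fin n) ℂ), IsUnit A → ∀ θ : ℝ,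
      N (matRe (Complex.exp (θ * Complex.I) • A)) ≤ N A := by
    intro A hA θ
    have h1 := hNa (Complex.exp (θ * Complex.I) • A) (Complex.exp (θ * Complex.I) • A)ᴴ
    rw [Matrix.conjTranspose_smul, hNs, hNs, norm_star, Complex.norm_exp_ofReal_mul_I,
      aux_adj hUI hA] at h1
    unfold matRe
    rw [hNs, Matrix.conjTranspose_smul]
    have h2 : ‖(1 / 2 : ℂ)‖ = 1 / 2 := by norm_num
    rw [h2]
    linarith
  have hunit : ∀ j, IsUnit (X j) := by
    intro j
    obtain ⟨z, hz, hs⟩ := hX j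
    have h0 : z ≠ 0 := by rintro rfl; simp at hz
    have := aux_unit hs
    have e : X j = (z⁻¹ • (1 : Matrix (Fin n) (Fin n) ℂ)) * (z • X j) := by
      rw [smul_mul_smul_comm, inv_mul_cancel₀ h0, one_mul, one_smul]
    rw [e]
    refine IsUnit.mul ?_ this
    refine IsUnit.of_mul_eq_one (z • 1) ?_
    rw [smul_mul_smul_comm, inv_mul_cancel₀ h0, one_mul, one_smul]
  have hj : ∀ j, N (X j) ≤ (Real.cos (α j))⁻¹ * gnr N (X j) := by
    intro j
    obtain ⟨z, hz, hs⟩ := hX j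
    have hc : 0 < Real.cos (α j) :=
      Real.cos_pos_of_mem_Ioo ⟨by linarith [(hα j).1, Real.pi_pos], (hα j).2⟩
    have h1 := aux_main hNs hNa hUI (hα j).1 (hα j).2 hs
    rw [hNs, hz, one_mul] at h1
    refine h1.trans (mul_le_mul_of_nonneg_left ?_ (inv_nonneg.2 hc.le))
    have hzz : z = Complex.exp ((z.arg : ℝ) * Complex.I) := by
      have := Complex.norm_mul_exp_arg_mul_I z
      rw [hz] at this
      simpa using this.symm
    have hb : BddAbove (Set.range fun θ : ℝ =>
        N (matRe (Complex.exp (θ * Complex.I) • X j))) := by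
      refine ⟨N (X j), ?_⟩
      rintro _ ⟨θ, rfl⟩
      exact hre _ (hunit j) θ
    have := le_ciSup hb z.arg
    beta_reduce at this
    rw [← hzz] at this
    exact this
  have hprodu : IsUnit (List.ofFn X).prod := by
    refine List.prod_isUnit ?_
    intro A hA
    obtain ⟨j, rfl⟩ := (List.mem_ofFn' _ _).1 hA
    exact hunit j
  rw [← Finset.prod_mul_distrib]
  refine (ciSup_le fun θ => hre _ hprodu θ).trans ?_
  obtain ⟨k, rfl⟩ : ∃ k, m = k + 1 := ⟨m - 1, by omega⟩
  exact (aux_prod hN hSM X).trans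
    (Finset.prod_le_prod (fun j _ => hN _) (fun j _ => hj j))
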